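/- arXiv:2309.13290 — 6 statements merged into one kernel-verified Lean document; each statement's English description precedes it below -/
import Mathlib

section
/- Let (X,d) be a compact metric space and f : X → X a continuous map. For any x,y ∈ X and r > 0, if x ∈ Sh(f) and y ∈ C(x) ∩ Ent_r(f), then x ∈ Ent_s(f) for all 0 < s < r. -/
open Filter Topology Set

section Defs

variable {X : Type*} [MetricSpace X]

/-- `c 0, c 1, ..., c k` is a `δ`-chain of `f`. -/
def IsDeltaChain (f : X → X) (δ : ℝ) (c : ℕ → X) (k : ℕ) : Prop :=
  ∀ i < k, dist (f (c i)) (c (i + 1)) ≤ δ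

/-- `x → y` : for every `δ > 0` there is a `δ`-chain of `f` from `x` to `y`. -/
def ChainReach (f : X → X) (x y : X) : Prop :=
  ∀ δ > 0, ∃ (c : ℕ → X) (k : ℕ), 1 ≤ k ∧ IsDeltaChain f δ c k ∧ c 0 = x ∧ c k = y

/-- `C(x) = {x} ∪ {y : x → y}`. -/
def CSet (f : X → X) (x : X) : Set X := {x} ∪ {y | ChainReach f x y}

/-- The chain recurrent set. -/
def CR (f : X → X) : Set X := {x | ChainReach f x x}

/-- `C` is a chain component of `f` : an equivalence class of `↔` on `CR f`. -/
def IsChainComponent (f : X → X) (C : Set X) : Prop :=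
  ∃ x ∈ CR f, C = {y ∈ CR f | ChainReach f x y ∧ ChainReach f y x}

/-- A set `S` is chain stable for `f`. -/
def ChainStable (f : X → X) (S : Set X) : Prop :=
  ∀ ε > 0, ∃ δ > 0, ∀ (c : ℕ → X) (k : ℕ), 1 ≤ k → IsDeltaChain f δ c k → c 0 ∈ S →
    ∀ i ≤ k, Metric.infDist (c i) S ≤ ε

/-- `ξ` is a `δ`-pseudo orbit of `f`. -/
def IsPseudoOrbit (f : X → X) (δ : ℝ) (ξ : ℕ → X) : Prop :=
  ∀ i, dist (f (ξ i)) (ξ (i + 1)) ≤ δ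

/-- `x` is a shadowable point of `f`. -/
def ShadowablePt (f : X → X) (x : X) : Prop :=
  ∀ ε > 0, ∃ δ > 0, ∀ ξ : ℕ → X, IsPseudoOrbit f δ ξ → ξ 0 = x →
    ∃ y, ∀ i, dist (f^[i] y) (ξ i) ≤ ε

/-- `f` has the shadowing on `S`. -/
def ShadowingOn (f : X → X) (S : Set X) : Prop :=
  ∀ ε > 0, ∃ δ > 0, ∀ ξ : ℕ → X, IsPseudoOrbit f δ ξ → (∀ i, ξ i ∈ S) →
    ∃ y, ∀ i, dist (f^[i] y) (ξ i) ≤ ε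

/-- `f` has the shadowing property. -/
def ShadowingProperty (f : X → X) : Prop :=
  ∀ ε > 0, ∃ δ > 0, ∀ ξ : ℕ → X, IsPseudoOrbit f δ ξ →
    ∃ y, ∀ i, dist (f^[i] y) (ξ i) ≤ ε

/-- `f` is chain transitive. -/
def ChainTransitive (f : X → X) : Prop := ∀ x y : X, ChainReach f x y

/-- `f` restricted to `S` is chain continuous. -/
def ChainContinuousOn (f : X → X) (S : Set X) : Prop :=
  ∀ ε > 0, ∃ δ > 0, ∀ ξ η : ℕ → X, IsPseudoOrbit f δ ξ → IsPseudoOrbit f δ η →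
    (∀ i, ξ i ∈ S) → (∀ i, η i ∈ S) → ξ 0 = η 0 → ∀ i, dist (ξ i) (η i) ≤ ε

/-- `f` restricted to `S` is equicontinuous. -/
def EquicontinuousOnSet (f : X → X) (S : Set X) : Prop :=
  ∀ ε > 0, ∃ δ > 0, ∀ x ∈ S, ∀ y ∈ S, dist x y ≤ δ → ∀ i : ℕ, dist (f^[i] x) (f^[i] y) ≤ ε

/-- `s_n(f,K,r)` : largest cardinality of an `(n,r)`-separated subset of `K`. -/
noncomputable def sepNum (f : X → X) (K : Set X) (n : ℕ) (r : ℝ) : ℕ :=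
  sSup {m | ∃ E : Finset X, (E : Set X) ⊆ K ∧
    (∀ x ∈ E, ∀ y ∈ E, x ≠ y → ∃ i < n, r < dist (f^[i] x) (f^[i] y)) ∧ E.card = m}

/-- `h(f,K,r) = limsup (1/n) log s_n(f,K,r)`. -/
noncomputable def entH (f : X → X) (K : Set X) (r : ℝ) : EReal :=
  Filter.limsup (fun n : ℕ => ((Real.log (sepNum f K n r) / n : ℝ) : EReal)) Filter.atTop

/-- `h(f,K) = lim_{r → 0} h(f,K,r) = sup_{r > 0} h(f,K,r)`. -/
noncomputable def ent (f : X → X) (K : Set X) : EReal :=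
  ⨆ r ∈ Set.Ioi (0 : ℝ), entH f K r

/-- `Ent_r(f)`. -/
def EntR (f : X → X) (r : ℝ) : Set X :=
  {x | ∀ K : Set X, IsClosed K → K ∈ 𝓝 x → 0 < entH f K r}

/-- `Ent_{r,b}(f)`. -/
def EntRB (f : X → X) (r b : ℝ) : Set X :=
  {x | ∀ K : Set X, IsClosed K → K ∈ 𝓝 x → (b : EReal) ≤ entH f K r}

/-- The ω-limit set of `x` under `f`. -/
def omegaLim (f : X → X) (x : X) : Set X :=
  {y | ∃ φ : ℕ → ℕ, StrictMono φ ∧ Tendsto (fun j => f^[φ j] x) atTop (𝓝 y)}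

/-- The set of `e`-sensitive points of `f` restricted to `S`. -/
def SenE (f : X → X) (S : Set X) (e : ℝ) : Set X :=
  {x ∈ S | ∀ ε > 0, ∃ y ∈ S, dist x y ≤ ε ∧ ∃ i : ℕ, e < dist (f^[i] x) (f^[i] y)}

/-- `Sen(f|_S) = ⋃_{e > 0} Sen_e(f|_S)`. -/
def Sen (f : X → X) (S : Set X) : Set X := ⋃ e ∈ Set.Ioi (0 : ℝ), SenE f S e

/-- `(x,y)` is a scrambled pair for `f`. -/
def ScrambledPair (f : X → X) (x y : X) : Prop :=
  0 < Filter.limsup (fun i : ℕ => dist (f^[i] x) (f^[i] y)) Filter.atTop ∧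
    Filter.liminf (fun i : ℕ => dist (f^[i] x) (f^[i] y)) Filter.atTop = 0

/-- `M` is a minimal set for `f`. -/
def IsMinimalSet (f : X → X) (M : Set X) : Prop :=
  IsClosed M ∧ MapsTo f M M ∧ ∀ S ⊆ M, IsClosed S → MapsTo f S S → S = ∅ ∨ S = M

/-- `Φ_ε(x)`. -/
def Phi (f : X → X) (ε : ℝ) (x : X) : Set X :=
  {y | ∀ i : ℕ, dist (f^[i] x) (f^[i] y) ≤ ε}

/-- `h*_f(ε) = sup_x h(f,Φ_ε(x))`. -/
noncomputable def hStar (f : X → X) (ε : ℝ) : EReal := ⨆ x : X, ent f (Phi f ε x)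

/-- `f` is h-expansive. -/
def HExpansive (f : X → X) : Prop := ∃ ε > 0, hStar f ε = 0

end Defs

/-- By compactness, the `(n, r)`-separated sets have uniformly bounded cardinality. -/
lemma bddAbove_card_separated {X : Type*} [MetricSpace X] [CompactSpace X] {f : X → X}
    (hf : Continuous f) (K : Set X) (n : ℕ) {r : ℝ} (hr : 0 < r) :
    BddAbove {m | ∃ E : Finset X, (E : Set X) ⊆ K ∧
      (∀ x ∈ E, ∀ y ∈ E, x ≠ y → ∃ i < n, r < dist (f^[i] x) (f^[i] y)) ∧ E.card = m} := by
  have hcont : Continuous fun (x : X) (i : Fin n) => f^[i] x :=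
    continuous_pi fun i => hf.iterate i
  obtain ⟨δ, hδ, hdist⟩ := Metric.uniformContinuous_iff.1
    (CompactSpace.uniformContinuous_of_continuous hcont) r hr
  obtain ⟨t, -, ht, hcover⟩ := finite_cover_balls_of_compact
    (isCompact_univ : IsCompact (univ : Set X)) (half_pos hδ)
  have hcenter (x : X) : ∃ c ∈ t, dist x c < δ / 2 := by
    simpa using hcover (mem_univ x)
  choose c hct hc using hcenter
  refine ⟨ht.toFinset.card, ?_⟩
  rintro _ ⟨E, -, hsep, rfl⟩
  refine Finset.card_le_card_of_injOn c (fun x _ => by simpa using hct x) ?_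
  intro x hx y hy hxy
  by_contra hne
  obtain ⟨i, hi, hlt⟩ := hsep x hx y hy hne
  have hxyδ : dist x y < δ := by
    have h := hc y
    rw [← hxy] at h
    linarith [dist_triangle_right x y (c x), hc x]
  exact hlt.not_gt ((dist_le_pi_dist _ _ (⟨i, hi⟩ : Fin n)).trans_lt (hdist hxyδ))

/-- If `w` maps the points of `L` to points of `K` whose orbits
`ε`-shadow the original ones after `k` steps, then separation numbers can be compared. -/
lemma sepNum_le_sepNum_add {X : Type*} [MetricSpace X] [CompactSpace X] {f : X → X}
    (hf : Continuous f) {K L : Set X} {r s ε : ℝ} (hs : 0 < s) (hε : s + 2 * ε ≤ r)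
    (k : ℕ) (w : X → X) (hwK : MapsTo w L K)
    (hw : ∀ z ∈ L, ∀ i, dist (f^[i + k] (w z)) (f^[i] z) ≤ ε) (n : ℕ) :
    sepNum f L n r ≤ sepNum f K (n + k) s := by
  classical
  refine csSup_le ⟨0, ∅, by simp⟩ ?_
  rintro _ ⟨E, hEL, hsep, rfl⟩
  have key : ∀ x ∈ E, ∀ y ∈ E, x ≠ y →
      ∃ i < n + k, s < dist (f^[i] (w x)) (f^[i] (w y)) := by
    intro x hx y hy hxy
    obtain ⟨i, hi, hlt⟩ := hsep x hx y hy hxy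
    refine ⟨i + k, by omega, ?_⟩
    have hwx := hw x (hEL hx) i
    have hwy := hw y (hEL hy) i
    rw [dist_comm] at hwx
    linarith [dist_triangle4 (f^[i] x) (f^[i + k] (w x)) (f^[i + k] (w y)) (f^[i] y)]
  have hinj : InjOn w E := by
    intro x hx y hy hxy
    by_contra hne
    obtain ⟨i, -, hlt⟩ := key x hx y hy hne
    rw [hxy, dist_self] at hlt
    exact hlt.not_gt hs
  refine le_csSup (bddAbove_card_separated hf K (n + k) hs)
    ⟨E.image w, ?_, ?_, Finset.card_image_of_injOn hinj⟩
  · rw [Finset.coe_image]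
    exact (hwK.mono_left hEL).image_subset
  · simp only [Finset.forall_mem_image]
    exact fun x hx y hy hxy => key x hx y hy fun h => hxy (h ▸ rfl)

/-- Positivity of the entropy is inherited through a comparison of separation numbers with a
bounded time delay. -/
lemma entH_pos_of_sepNum_le {X : Type*} [MetricSpace X] {f : X → X} {K L : Set X} {r s : ℝ}
    (k : ℕ) (h : ∀ n, sepNum f L n r ≤ sepNum f K (n + k) s) (hL : 0 < entH f L r) :
    0 < entH f K s := by
  obtain ⟨a, ha, haL⟩ := EReal.lt_iff_exists_real_btwn.1 hL
  have ha : 0 < a := by exact_mod_cast ha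
  have hfreq : ∃ᶠ n : ℕ in atTop, ((a / 2 : ℝ) : EReal) ≤
      ((Real.log (sepNum f K n s) / n : ℝ) : EReal) := by
    refine (tendsto_add_atTop_nat k).frequently
      (((frequently_lt_of_lt_limsup (by isBoundedDefault) haL).and_eventually
        (eventually_ge_atTop (k + 1))).mono ?_)
    rintro n ⟨hlt, hn⟩
    have hlt := EReal.coe_lt_coe_iff.1 hlt
    have hkn : (k : ℝ) + 1 ≤ n := by exact_mod_cast hn
    have hn0 : (0 : ℝ) < n := by linarith [k.cast_nonneg (α := ℝ)]
    rw [lt_div_iff₀ hn0] at hlt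
    have hpos : 0 < sepNum f L n r := by
      rcases Nat.eq_zero_or_pos (sepNum f L n r) with h0 | h0
      · rw [h0, Nat.cast_zero, Real.log_zero] at hlt
        nlinarith
      · exact h0
    have hlog : Real.log (sepNum f L n r) ≤ Real.log (sepNum f K (n + k) s) :=
      Real.log_le_log (by exact_mod_cast hpos) (by exact_mod_cast h n)
    rw [EReal.coe_le_coe_iff, le_div_iff₀ (by push_cast; positivity)]
    push_cast
    nlinarith
  calc (0 : EReal) < ((a / 2 : ℝ) : EReal) := by exact_mod_cast half_pos ha
    _ ≤ entH f K s := le_limsup_of_frequently_le hfreq (by isBoundedDefault)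

/-- A point reaching `z` along a `δ`-chain can be continued by the orbit of a point near `z`. -/
lemma IsDeltaChain.isPseudoOrbit_concat {X : Type*} [MetricSpace X] {f : X → X} {δ : ℝ}
    (hδ : 0 < δ) {c : ℕ → X} {k : ℕ} (hc : IsDeltaChain f (δ / 2) c k) {z : X}
    (hz : dist (c k) z ≤ δ / 2) :
    IsPseudoOrbit f δ fun i => if i < k then c i else f^[i - k] z := by
  intro i
  dsimp only
  rcases lt_trichotomy (i + 1) k with hi | rfl | hi
  · rw [if_pos (by omega), if_pos hi]
    linarith [hc i (by omega)]
  · rw [if_pos (by omega), if_neg (by omega), Nat.sub_self, Function.iterate_zero_apply]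
    linarith [hc i (by omega), dist_triangle (f (c i)) (c (i + 1)) z]
  · rw [if_neg (by omega), if_neg (by omega), Nat.sub_add_comm (by omega),
      Function.iterate_succ_apply', dist_self]
    exact hδ.le

/-- Lemma 3.1 (1): if `x ∈ Sh(f)` and `y ∈ C(x) ∩ Ent_r(f)`, then `x ∈ Ent_s(f)` for
all `0 < s < r`. -/
theorem stmt_10 {X : Type*} [MetricSpace X] [CompactSpace X] (f : X → X)
    (hf : Continuous f) (x y : X) (r : ℝ) (hr : 0 < r)
    (hx : ShadowablePt f x) (hy : y ∈ CSet f x ∩ EntR f r) :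
    ∀ s : ℝ, 0 < s → s < r → x ∈ EntR f s := by
  intro s hs hsr K hKcl hK
  obtain ⟨hyC | hxy, hyE⟩ := hy
  · obtain rfl : y = x := hyC
    exact entH_pos_of_sepNum_le 0
      (sepNum_le_sepNum_add hf (ε := 0) hs (by linarith) 0 id (mapsTo_id K) (by simp))
      (hyE K hKcl hK)
  obtain ⟨ε₀, hε₀, hballK⟩ := Metric.nhds_basis_closedBall.mem_iff.1 hK
  set ε := min ε₀ ((r - s) / 2)
  have hε : 0 < ε := lt_min hε₀ (by linarith)
  have hεs : ε ≤ (r - s) / 2 := min_le_right _ _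
  obtain ⟨δ, hδ, hshadow⟩ := hx ε hε
  obtain ⟨c, k, hk, hc, hc0, hck⟩ := hxy (δ / 2) (half_pos hδ)
  have hexists (z : X) : ∃ w, z ∈ Metric.closedBall y (δ / 2) →
      ∀ i, dist (f^[i] w) (if i < k then c i else f^[i - k] z) ≤ ε := by
    by_cases hz : z ∈ Metric.closedBall y (δ / 2)
    · obtain ⟨w, hw⟩ := hshadow _
        (hc.isPseudoOrbit_concat hδ (by rw [hck]; exact Metric.mem_closedBall'.1 hz))
        (by rw [if_pos (by omega), hc0])
      exact ⟨w, fun _ => hw⟩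
    · exact ⟨z, fun h => absurd h hz⟩
  choose w hw using hexists
  refine entH_pos_of_sepNum_le k
    (sepNum_le_sepNum_add hf (ε := ε) hs (by linarith) k w ?_ ?_)
    (hyE (Metric.closedBall y (δ / 2)) Metric.isClosed_closedBall
      (Metric.closedBall_mem_nhds y (half_pos hδ)))
  · intro z hz
    have h0 := hw z hz 0
    rw [if_pos (by omega), hc0, Function.iterate_zero_apply] at h0
    exact hballK (Metric.mem_closedBall.2 (h0.trans (min_le_left _ _)))
  · intro z hz i
    simpa using hw z hz (i + k)
end

section
/- Let (X,d) be a compact metric space and f : X → X a continuous map. Then the topological entropy of f satisfies h_top(f) = lim_{r→0} lim_{δ→0} limsup_{n→∞} (1/n) log s_n(f,X,r,δ), where s_n(f,X,r,δ) is the largest cardinality of a set of pairwise (n,r)-separated δ-chains of f of length n. -/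
open Filter Topology Set

/-- `s_n(f,X,r,δ)` : largest cardinality of a set of pairwise `(n,r)`-separated
`δ`-chains of `f` of length `n`. -/
noncomputable def sepNumChains {X : Type*} [MetricSpace X] (f : X → X)
    (n : ℕ) (r δ : ℝ) : ℕ :=
  sSup {m | ∃ E : Finset (ℕ → X), (∀ c ∈ E, IsDeltaChain f δ c n) ∧
    (∀ c ∈ E, ∀ c' ∈ E, c ≠ c' → ∃ i ≤ n, r < dist (c i) (c' i)) ∧ E.card = m}

section ChainEntropy

variable {X : Type*} [MetricSpace X]

/-- A finite set whose elements are determined by their `K`-letter codes over the alphabet `T`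
has at most `T.card ^ K` elements. -/
lemma Finset.card_le_pow_of_code {α Y : Type*} (E : Finset α) (T : Finset Y) (K : ℕ)
    (φ : α → ℕ → Y) (hT : ∀ c k, φ c k ∈ T)
    (hinj : ∀ c ∈ E, ∀ c' ∈ E, (∀ k < K, φ c k = φ c' k) → c = c') :
    E.card ≤ T.card ^ K := by
  have h : E.card ≤ (Fintype.piFinset (fun _ : Fin K => T)).card := by
    refine Finset.card_le_card_of_injOn (fun c k => φ c k) ?_ ?_
    · intro c _
      simp [hT]
    · intro c hc c' hc' h
      exact hinj c hc c' hc' fun k hk => congrFun h ⟨k, hk⟩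
  simpa using h

/-- The cardinalities of families of `(n,r)`-separated chains are bounded. -/
lemma bddAbove_card_separated_chains [CompactSpace X] (f : X → X) (n : ℕ) {r : ℝ} (hr : 0 < r)
    (δ : ℝ) :
    BddAbove {m | ∃ E : Finset (ℕ → X), (∀ c ∈ E, IsDeltaChain f δ c n) ∧
      (∀ c ∈ E, ∀ c' ∈ E, c ≠ c' → ∃ i ≤ n, r < dist (c i) (c' i)) ∧ E.card = m} := by
  obtain ⟨t, -, ht, hcov⟩ := finite_cover_balls_of_compact (isCompact_univ (X := X)) (half_pos hr)
  have hex : ∀ x : X, ∃ y ∈ ht.toFinset, dist x y < r / 2 := by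
    intro x
    simpa using hcov (Set.mem_univ x)
  choose g hgt hg using hex
  refine ⟨ht.toFinset.card ^ (n + 1), ?_⟩
  rintro _ ⟨E, -, hsep, rfl⟩
  refine Finset.card_le_pow_of_code E _ _ (fun c k => g (c k)) (fun c k => hgt _) ?_
  intro c hc c' hc' h
  by_contra hne
  obtain ⟨i, hi, hlt⟩ := hsep c hc c' hc' hne
  have hgi : g (c i) = g (c' i) := h i (by omega)
  have h1 := hg (c i)
  have h2 := hg (c' i)
  rw [← hgi] at h2
  linarith [dist_triangle_right (c i) (c' i) (g (c i))]

/-- Orbits are chains, so cardinalities of separated sets of points are also cardinalities of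
separated sets of chains. -/
lemma separated_subset_separated_chains (f : X → X) (K : Set X) (n : ℕ) (r : ℝ) {δ : ℝ}
    (hδ : 0 ≤ δ) :
    {m | ∃ E : Finset X, (E : Set X) ⊆ K ∧
      (∀ x ∈ E, ∀ y ∈ E, x ≠ y → ∃ i < n, r < dist (f^[i] x) (f^[i] y)) ∧ E.card = m} ⊆
    {m | ∃ E : Finset (ℕ → X), (∀ c ∈ E, IsDeltaChain f δ c n) ∧
      (∀ c ∈ E, ∀ c' ∈ E, c ≠ c' → ∃ i ≤ n, r < dist (c i) (c' i)) ∧ E.card = m} := by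
  classical
  rintro _ ⟨E, -, hsep, rfl⟩
  refine ⟨E.image (fun x i => f^[i] x), ?_, ?_, ?_⟩
  · intro c hc i _
    obtain ⟨x, -, rfl⟩ := Finset.mem_image.1 hc
    simpa [Function.iterate_succ_apply'] using hδ
  · intro c hc c' hc' hne
    obtain ⟨x, hx, rfl⟩ := Finset.mem_image.1 hc
    obtain ⟨y, hy, rfl⟩ := Finset.mem_image.1 hc'
    obtain ⟨i, hi, h⟩ := hsep x hx y hy fun hxy => hne (by rw [hxy])
    exact ⟨i, hi.le, h⟩
  · exact Finset.card_image_of_injective _ fun x y h => congrFun h 0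

lemma sepNum_le_sepNumChains [CompactSpace X] (f : X → X) (K : Set X) (n : ℕ) {r δ : ℝ}
    (hr : 0 < r) (hδ : 0 ≤ δ) : sepNum f K n r ≤ sepNumChains f n r δ :=
  csSup_le_csSup (bddAbove_card_separated_chains f n hr δ) ⟨0, ∅, by simp⟩
    (separated_subset_separated_chains f K n r hδ)

/-- A separated set of maximal cardinality is spanning. -/
lemma exists_spanning_card_eq_sepNum [CompactSpace X] (f : X → X) (n : ℕ) {r : ℝ} (hr : 0 < r) :
    ∃ E : Finset X, E.card = sepNum f Set.univ n r ∧
      ∀ x, ∃ y ∈ E, ∀ i < n, dist (f^[i] x) (f^[i] y) ≤ r := by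
  classical
  have hbdd := (bddAbove_card_separated_chains f n hr 0).mono
    (separated_subset_separated_chains f Set.univ n r le_rfl)
  have hne : Set.Nonempty {m | ∃ E : Finset X, (E : Set X) ⊆ Set.univ ∧
      (∀ x ∈ E, ∀ y ∈ E, x ≠ y → ∃ i < n, r < dist (f^[i] x) (f^[i] y)) ∧ E.card = m} :=
    ⟨0, ∅, by simp⟩
  obtain ⟨E, -, hsep, hcard⟩ := Nat.sSup_mem hne hbdd
  refine ⟨E, hcard, fun x => ?_⟩
  by_contra! hx
  have hxE : x ∉ E := fun h => by
    obtain ⟨i, -, hi⟩ := hx x h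
    rw [dist_self] at hi
    exact hr.not_gt hi
  have hle := le_csSup hbdd (a := (insert x E).card) ⟨insert x E, Set.subset_univ _, ?_, rfl⟩
  · rw [Finset.card_insert_of_notMem hxE, ← hcard] at hle
    omega
  · intro y hy z hz hyz
    rcases Finset.mem_insert.1 hy with rfl | hyE <;> rcases Finset.mem_insert.1 hz with rfl | hzE
    · exact absurd rfl hyz
    · exact hx z hzE
    · simpa only [dist_comm] using hx y hyE
    · exact hsep y hyE z hzE hyz

/-- Chains with small jumps follow the orbit of their initial point for a prescribed time. -/
lemma exists_chain_close_orbit [CompactSpace X] {f : X → X} (hf : Continuous f) (m : ℕ) :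
    ∀ ε > 0, ∃ δ > 0, ∀ (c : ℕ → X) (n : ℕ), IsDeltaChain f δ c n →
      ∀ i ≤ m, i ≤ n → dist (c i) (f^[i] (c 0)) ≤ ε := by
  induction m with
  | zero =>
    intro ε hε
    refine ⟨1, one_pos, fun c n _ i hi _ => ?_⟩
    obtain rfl : i = 0 := by omega
    simpa using hε.le
  | succ m ih =>
    intro ε hε
    obtain ⟨η, hη, hfη⟩ := Metric.uniformContinuous_iff.1
      (CompactSpace.uniformContinuous_of_continuous hf) (ε / 2) (half_pos hε)
    obtain ⟨δ, hδ, h⟩ := ih (η / 2) (half_pos hη)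
    refine ⟨min δ (ε / 2), lt_min hδ (half_pos hε), fun c n hc i hi hin => ?_⟩
    cases i with
    | zero => simpa using hε.le
    | succ j =>
      have hj := h c n (fun k hk => (hc k hk).trans (min_le_left _ _)) j (by omega) (by omega)
      have h1 : dist (f (c j)) (f (f^[j] (c 0))) < ε / 2 := hfη (by linarith)
      have h2 : dist (f (c j)) (c (j + 1)) ≤ ε / 2 := (hc j (by omega)).trans (min_le_right _ _)
      rw [Function.iterate_succ_apply']
      linarith [dist_triangle_left (c (j + 1)) (f (f^[j] (c 0))) (f (c j))]

/-- Cutting chains into blocks of length `m` bounds the number of separated chains. -/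
lemma exists_sepNumChains_le_pow [CompactSpace X] {f : X → X} (hf : Continuous f) {m : ℕ}
    (hm : 0 < m) {r : ℝ} (hr : 0 < r) :
    ∃ δ > 0, ∀ n, sepNumChains f n r δ ≤ sepNum f Set.univ m (r / 4) ^ (n / m + 1) := by
  have hr4 : 0 < r / 4 := by positivity
  obtain ⟨T, hT, hspan⟩ := exists_spanning_card_eq_sepNum f m hr4
  choose g hgT hg using hspan
  obtain ⟨δ, hδ, hclose⟩ := exists_chain_close_orbit hf m (r / 4) hr4
  refine ⟨δ, hδ, fun n => csSup_le ⟨0, ∅, by simp⟩ ?_⟩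
  rintro _ ⟨E, hE, hsep, rfl⟩
  rw [← hT]
  refine Finset.card_le_pow_of_code E T _ (fun c k => g (c (m * k))) (fun c k => hgT _) ?_
  intro c hc c' hc' h
  by_contra hne
  obtain ⟨i, hi, hlt⟩ := hsep c hc c' hc' hne
  have hmod := Nat.mod_lt i hm
  have hdiv := Nat.div_add_mod i m
  have hblock : ∀ b ∈ E, dist (b i) (f^[i % m] (g (b (m * (i / m))))) ≤ r / 2 := by
    intro b hb
    have h1 := hclose (fun j => b (m * (i / m) + j)) (i % m)
      (fun j hj => hE b hb _ (by omega)) (i % m) hmod.le le_rfl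
    have h2 := hg (b (m * (i / m))) (i % m) hmod
    simp only [hdiv, add_zero] at h1
    linarith [dist_triangle (b i) (f^[i % m] (b (m * (i / m))))
      (f^[i % m] (g (b (m * (i / m)))))]
  have h1 := hblock c hc
  have h2 := hblock c' hc'
  have hcode : g (c (m * (i / m))) = g (c' (m * (i / m))) :=
    h (i / m) (Nat.lt_succ_of_le (Nat.div_le_div_right hi))
  rw [← hcode] at h2
  linarith [dist_triangle_right (c i) (c' i) (f^[i % m] (g (c (m * (i / m)))))]

lemma log_natCast_le_log_natCast {a b : ℕ} (h : a ≤ b) : Real.log a ≤ Real.log b := by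
  rcases Nat.eq_zero_or_pos a with rfl | ha
  · simpa using Real.log_natCast_nonneg b
  · exact Real.log_le_log (by exact_mod_cast ha) (by exact_mod_cast h)

/-- Submultiplicative growth along blocks of length `m` bounds the exponential growth rate. -/
lemma limsup_log_div_le_of_le_pow {u : ℕ → ℕ} {s m : ℕ} (h : ∀ n, u n ≤ s ^ (n / m + 1)) :
    limsup (fun n : ℕ => ((Real.log (u n) / n : ℝ) : EReal)) atTop ≤
      ((Real.log s / m : ℝ) : EReal) := by
  have hlim : Tendsto (fun n : ℕ => ((Real.log s / m + Real.log s / n : ℝ) : EReal)) atTop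
      (𝓝 ((Real.log s / m : ℝ) : EReal)) := by
    refine (continuous_coe_real_ereal.tendsto _).comp ?_
    simpa using tendsto_const_nhds.add (tendsto_const_div_atTop_nhds_zero_nat (Real.log s))
  rw [← hlim.limsup_eq]
  refine limsup_le_limsup ?_
  filter_upwards [eventually_gt_atTop 0] with n hn
  have hn' : (0 : ℝ) < n := by exact_mod_cast hn
  have hs := Real.log_natCast_nonneg s
  have hlog := log_natCast_le_log_natCast (h n)
  rw [Nat.cast_pow, Real.log_pow] at hlog
  have hdiv : ((n / m + 1 : ℕ) : ℝ) ≤ n / m + 1 := by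
    push_cast
    gcongr
    exact Nat.cast_div_le
  rw [EReal.coe_le_coe_iff, div_le_iff₀ hn']
  calc Real.log (u n) ≤ (n / m + 1) * Real.log s := hlog.trans (by gcongr)
    _ = (Real.log s / m + Real.log s / n) * n := by field_simp

end ChainEntropy

/-- Lemma 3.2 (Misiurewicz):
`h_top(f) = lim_{r→0} lim_{δ→0} limsup_n (1/n) log s_n(f,X,r,δ)`. -/
theorem stmt_12 {X : Type*} [MetricSpace X] [CompactSpace X] (f : X → X)
    (hf : Continuous f) :
    ent f Set.univ =
      ⨆ r ∈ Set.Ioi (0 : ℝ), ⨅ δ ∈ Set.Ioi (0 : ℝ),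
        Filter.limsup (fun n : ℕ =>
          ((Real.log (sepNumChains f n r δ) / n : ℝ) : EReal)) Filter.atTop := by
  apply le_antisymm
  · refine iSup₂_mono fun r hr => le_iInf₂ fun δ hδ => limsup_le_limsup ?_
    refine Eventually.of_forall fun n => EReal.coe_le_coe_iff.2 ?_
    have hlog := log_natCast_le_log_natCast
      (sepNum_le_sepNumChains f Set.univ n (Set.mem_Ioi.1 hr) (Set.mem_Ioi.1 hδ).le)
    gcongr
  · refine iSup₂_le fun r hr => ?_
    have hr4 : 0 < r / 4 := div_pos hr (by norm_num)
    refine le_trans ?_ (le_iSup₂ (f := fun r (_ : r ∈ Set.Ioi (0 : ℝ)) => entH f Set.univ r)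
      (r / 4) hr4)
    refine le_limsup_of_frequently_le (Eventually.frequently ?_)
    filter_upwards [eventually_gt_atTop 0] with m hm
    obtain ⟨δ, hδ, hpow⟩ := exists_sepNumChains_le_pow hf hm hr
    exact (iInf₂_le δ hδ).trans (limsup_log_div_le_of_le_pow hpow)
end

section
/- Let (X,d) be a compact metric space, f : X → X a continuous map, and C a chain component of f. For every ε > 0 there is δ > 0 such that every δ-chain (x_i)_{i=0}^k of f consisting of points of CR(f) with x_0 ∈ C satisfies d(x_i,C) ≤ ε for all 0 ≤ i ≤ k. -/
open Filter Topology Set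

/-- A single step of a `δ`-chain of `f`. -/
def DeltaStep {X : Type*} [MetricSpace X] (f : X → X) (δ : ℝ) (x y : X) : Prop :=
  dist (f x) y ≤ δ

lemma DeltaStep.mono {X : Type*} [MetricSpace X] (f : X → X) {δ δ' : ℝ} (h : δ ≤ δ') :
    DeltaStep f δ ≤ DeltaStep f δ' :=
  fun _ _ hab => le_trans hab h

lemma DeltaStep.transGen_mono {X : Type*} [MetricSpace X] {f : X → X} {δ δ' : ℝ}
    (h : δ ≤ δ') {x y : X} (hxy : Relation.TransGen (DeltaStep f δ) x y) :
    Relation.TransGen (DeltaStep f δ') x y :=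
  Relation.TransGen.mono (DeltaStep.mono f h) _ _ hxy

lemma IsDeltaChain.transGen {X : Type*} [MetricSpace X] {f : X → X} {δ : ℝ} {c : ℕ → X}
    {k : ℕ} (hk : 1 ≤ k) (h : IsDeltaChain f δ c k) :
    Relation.TransGen (DeltaStep f δ) (c 0) (c k) := by
  induction k, hk using Nat.le_induction with
  | base => exact .single (h 0 one_pos)
  | succ k _ ih => exact (ih fun i hi => h i (by omega)).tail (h k (by omega))

lemma exists_isDeltaChain_iff_transGen {X : Type*} [MetricSpace X] {f : X → X} {δ : ℝ}
    {x y : X} : (∃ (c : ℕ → X) (k : ℕ), 1 ≤ k ∧ IsDeltaChain f δ c k ∧ c 0 = x ∧ c k = y) ↔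
      Relation.TransGen (DeltaStep f δ) x y := by
  constructor
  · rintro ⟨c, k, hk, h, rfl, rfl⟩
    exact h.transGen hk
  · intro h
    induction h with
    | @single b hb =>
      refine ⟨fun i => if i = 0 then x else b, 1, le_rfl, fun i hi => ?_, by simp, by simp⟩
      obtain rfl : i = 0 := by omega
      simpa [DeltaStep] using hb
    | @tail b z _ hz ih =>
      obtain ⟨c, k, hk, h, h0, hb⟩ := ih
      refine ⟨fun i => if i ≤ k then c i else z, k + 1, by omega, fun i hi => ?_, by simpa,
        by simp⟩
      rcases Nat.lt_succ_iff_lt_or_eq.mp hi with hi | rfl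
      · simpa [hi.le, Nat.succ_le_of_lt hi] using h i hi
      · simpa [hb, DeltaStep] using hz

lemma chainReach_iff_transGen {X : Type*} [MetricSpace X] {f : X → X} {x y : X} :
    ChainReach f x y ↔ ∀ δ > 0, Relation.TransGen (DeltaStep f δ) x y := by
  simp only [ChainReach, exists_isDeltaChain_iff_transGen]

lemma ChainReach.trans {X : Type*} [MetricSpace X] {f : X → X} {x y z : X}
    (h : ChainReach f x y) (h' : ChainReach f y z) : ChainReach f x z := by
  rw [chainReach_iff_transGen] at *
  exact fun δ hδ => (h δ hδ).trans (h' δ hδ)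

/-- The starting point of a chain may be perturbed. -/
lemma exists_transGen_of_dist_lt_left {X : Type*} [MetricSpace X] [CompactSpace X] {f : X → X}
    (hf : Continuous f) {δ : ℝ} (hδ : 0 < δ) :
    ∃ η > 0, ∀ a b p : X, dist a b < η → Relation.TransGen (DeltaStep f η) b p →
      Relation.TransGen (DeltaStep f δ) a p := by
  obtain ⟨η, hη, h⟩ := Metric.uniformContinuous_iff.mp
    (CompactSpace.uniformContinuous_of_continuous hf) (δ / 2) (half_pos hδ)
  refine ⟨min η (δ / 2), by positivity, fun a b p hab hbp => ?_⟩
  obtain ⟨z, hz, hzp⟩ := Relation.TransGen.head'_iff.mp hbp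
  refine Relation.TransGen.head'_iff.mpr ⟨z, ?_, Relation.ReflTransGen.mono
    (DeltaStep.mono f ((min_le_right _ _).trans (by linarith))) _ _ hzp⟩
  have h1 := h (hab.trans_le (min_le_left _ _))
  have h2 : dist (f b) z ≤ δ / 2 := le_trans hz (min_le_right _ _)
  have h3 := dist_triangle (f a) (f b) z
  change dist (f a) z ≤ δ
  linarith

/-- The end point of a chain may be perturbed. -/
lemma transGen_of_dist_le_right {X : Type*} [MetricSpace X] {f : X → X} {δ η : ℝ} (hη : 0 ≤ η)
    {x a b : X} (hab : dist a b ≤ η) (h : Relation.TransGen (DeltaStep f δ) x a) :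
    Relation.TransGen (DeltaStep f (δ + η)) x b := by
  obtain ⟨z, hxz, hz⟩ := Relation.TransGen.tail'_iff.mp h
  refine Relation.TransGen.tail'_iff.mpr ⟨z, Relation.ReflTransGen.mono
    (DeltaStep.mono f (by linarith)) _ _ hxz, ?_⟩
  exact (dist_triangle (f z) a b).trans (add_le_add hz hab)

/-- A sufficiently fine step leaving a chain recurrent point can be reversed by a chain. -/
lemma exists_transGen_symm_of_mem_CR {X : Type*} [MetricSpace X] [CompactSpace X] {f : X → X}
    (hf : Continuous f) {δ : ℝ} (hδ : 0 < δ) :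
    ∃ η > 0, ∀ u v : X, u ∈ CR f → DeltaStep f η u v →
      Relation.TransGen (DeltaStep f δ) v u := by
  obtain ⟨η, hη, h⟩ := exists_transGen_of_dist_lt_left hf hδ
  refine ⟨η / 3, by positivity, fun u v hu huv => ?_⟩
  have huu := chainReach_iff_transGen.mp hu (η / 3) (by positivity)
  obtain ⟨z, hz, hzu⟩ := Relation.TransGen.head'_iff.mp huu
  refine h v z u ?_ (DeltaStep.transGen_mono (by linarith) (huu.trans_right hzu))
  have h1 := dist_triangle_left v z (f u)
  have h2 : dist (f u) v ≤ η / 3 := huv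
  have h3 : dist (f u) z ≤ η / 3 := hz
  linarith

/-- A sufficiently fine chain of chain recurrent points can be reversed. -/
lemma exists_reflTransGen_symm_of_forall_mem_CR {X : Type*} [MetricSpace X] [CompactSpace X]
    {f : X → X} (hf : Continuous f) {δ : ℝ} (hδ : 0 < δ) :
    ∃ η > 0, ∀ (c : ℕ → X) (k : ℕ), IsDeltaChain f η c k → (∀ i ≤ k, c i ∈ CR f) →
      ∀ i ≤ k, Relation.ReflTransGen (DeltaStep f δ) (c i) (c 0) := by
  obtain ⟨η, hη, h⟩ := exists_transGen_symm_of_mem_CR hf hδ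
  refine ⟨η, hη, fun c k hc hCR i => ?_⟩
  induction i with
  | zero => exact fun _ => .refl
  | succ i ih =>
    exact fun hi => (h _ _ (hCR i (by omega)) (hc i hi)).to_reflTransGen.trans (ih (by omega))

/-- Lemma 3.3: for a chain component `C` and `ε > 0` there is `δ > 0` such that every
`δ`-chain of `f|_{CR(f)}` starting in `C` stays `ε`-close to `C`. -/
theorem stmt_13 {X : Type*} [MetricSpace X] [CompactSpace X] (f : X → X)
    (hf : Continuous f) (C : Set X) (hC : IsChainComponent f C) :
    ∀ ε > 0, ∃ δ > 0, ∀ (c : ℕ → X) (k : ℕ), 1 ≤ k → IsDeltaChain f δ c k →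
      (∀ i ≤ k, c i ∈ CR f) → c 0 ∈ C → ∀ i ≤ k, Metric.infDist (c i) C ≤ ε := by
  intro ε hε
  by_contra! hcon
  obtain ⟨p, hp, rfl⟩ := hC
  have hpos (n : ℕ) : (0 : ℝ) < 1 / ((n : ℝ) + 1) := Nat.one_div_pos_of_nat
  choose c k _ hc hCR h0 i hi hfar using fun n : ℕ => hcon _ (hpos n)
  obtain ⟨y, -, φ, hφ, hy⟩ :=
    isCompact_univ.tendsto_subseq (x := fun n => c n (i n)) fun _ => mem_univ _
  have hδ : Tendsto (fun n => 1 / ((φ n : ℝ) + 1)) atTop (𝓝 0) :=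
    tendsto_one_div_add_atTop_nhds_zero_nat.comp hφ.tendsto_atTop
  have hpy : ChainReach f p y := by
    refine chainReach_iff_transGen.mpr fun δ hδ0 => ?_
    obtain ⟨n, hn, hyn⟩ := ((hδ.eventually_lt_const (half_pos hδ0)).and
      (Metric.tendsto_nhds.mp hy _ (half_pos hδ0))).exists
    have hreach : Relation.TransGen (DeltaStep f (δ / 2)) p (c (φ n) (i (φ n))) := by
      have hp0 := chainReach_iff_transGen.mp (h0 (φ n)).2.1 (δ / 2) (half_pos hδ0)
      rcases Nat.eq_zero_or_pos (i (φ n)) with hz | hz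
      · rwa [hz]
      · refine hp0.trans (DeltaStep.transGen_mono hn.le ?_)
        exact IsDeltaChain.transGen hz fun j hj => hc (φ n) j (hj.trans_le (hi _))
    simpa using transGen_of_dist_le_right (half_pos hδ0).le hyn.le hreach
  have hyp : ChainReach f y p := by
    refine chainReach_iff_transGen.mpr fun δ hδ0 => ?_
    obtain ⟨η, hη, hleft⟩ := exists_transGen_of_dist_lt_left hf hδ0
    obtain ⟨γ, hγ, hrev⟩ := exists_reflTransGen_symm_of_forall_mem_CR hf hη
    obtain ⟨n, hn, hyn⟩ := ((hδ.eventually_lt_const hγ).and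
      (Metric.tendsto_nhds.mp hy _ hη)).exists
    refine hleft y _ p (by rwa [dist_comm]) ?_
    exact (chainReach_iff_transGen.mp (h0 (φ n)).2.2 η hη).trans_right
      (hrev _ _ (fun j hj => (hc (φ n) j hj).trans hn.le) (hCR (φ n)) _ (hi _))
  have hmem : y ∈ {y ∈ CR f | ChainReach f p y ∧ ChainReach f y p} :=
    ⟨hyp.trans hpy, hpy, hyp⟩
  obtain ⟨n, hn⟩ := (Metric.tendsto_nhds.mp hy _ hε).exists
  exact lt_irrefl _ ((hfar (φ n)).trans_le ((Metric.infDist_le_dist_of_mem hmem).trans hn.le))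
end

section
/- Let (X,d) be a compact metric space, f : X → X a homeomorphism, and F : X → X a factor map from (X,f) to itself (i.e. a continuous surjection with F ∘ f = f ∘ F) such that (a) F is an open map, and (b) d(v,v') ≥ 1 for every t ∈ X and all distinct v,v' ∈ F^{-1}(t). Suppose (x_i)_{i≥0} is a limit-pseudo orbit of f which is limit-shadowed by x ∈ X, and (z_i)_{i≥0} is a limit-pseudo orbit of f with z_i ∈ F^{-1}(x_i) for all i ≥ 0. Then there exists z ∈ F^{-1}(x) such that (z_i)_{i≥0} is limit-shadowed by z. -/
open Filter Topology Set

/-- Fibers of an open continuous surjection of a compact metric space vary lower semicontinuously: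
a sequence whose image is asymptotic to `τ` is asymptotic to some lift of `τ`. -/
theorem IsOpenMap.exists_asymptotic_lift {X Y : Type*} [MetricSpace X] [CompactSpace X]
    [MetricSpace Y] {F : X → Y} (hFopen : IsOpenMap F) (hFc : Continuous F)
    (hFs : Function.Surjective F) (ζ : ℕ → X) (τ : ℕ → Y)
    (h : Tendsto (fun i => dist (τ i) (F (ζ i))) atTop (𝓝 0)) :
    ∃ w : ℕ → X, (∀ i, F (w i) = τ i) ∧ Tendsto (fun i => dist (w i) (ζ i)) atTop (𝓝 0) := by
  have nearest : ∀ i, ∃ w, F w = τ i ∧ ∀ v, F v = τ i → dist w (ζ i) ≤ dist v (ζ i) := by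
    intro i
    have hK : IsCompact (F ⁻¹' {τ i}) := (isClosed_singleton.preimage hFc).isCompact
    obtain ⟨w, hw, hmin⟩ := hK.exists_isMinOn (hFs (τ i))
      (f := fun v => dist v (ζ i)) (by fun_prop)
    exact ⟨w, hw, fun v hv => hmin hv⟩
  choose w hw hmin using nearest
  refine ⟨w, hw, ?_⟩
  rw [tendsto_iff_ultrafilter]
  intro U hU
  obtain ⟨a, -, ha⟩ := isCompact_univ.ultrafilter_le_nhds (U.map ζ) (by simp)
  have hζa : Tendsto ζ U (𝓝 a) := ha
  have hτ : Tendsto τ U (𝓝 (F a)) :=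
    ((hFc.tendsto a).comp hζa).congr_dist ((h.mono_left hU).congr fun i => dist_comm _ _)
  rw [Metric.tendsto_nhds]
  intro ε hε
  have himg : F '' Metric.ball a (ε / 2) ∈ 𝓝 (F a) :=
    hFopen.image_mem_nhds (Metric.ball_mem_nhds a (half_pos hε))
  filter_upwards [hτ himg, hζa (Metric.ball_mem_nhds a (half_pos hε))] with i hi hζi
  obtain ⟨v, hv, hvτ⟩ := hi
  rw [Real.dist_0_eq_abs, abs_of_nonneg dist_nonneg]
  have h1 := hmin i v hvτ
  have h2 := dist_triangle_right v (ζ i) a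
  have h3 : dist v a < ε / 2 := hv
  have h4 : dist (ζ i) a < ε / 2 := hζi
  linarith

/-- Lemma 4.2: lifting of limit shadowing through an open factor map with
`1`-separated fibers. -/
theorem stmt_15 {X : Type*} [MetricSpace X] [CompactSpace X] (f : X → X)
    (hf : Continuous f) (hfb : Function.Bijective f)
    (F : X → X) (hFc : Continuous F) (hFs : Function.Surjective F)
    (hFf : F ∘ f = f ∘ F) (hFopen : IsOpenMap F)
    (hfib : ∀ t : X, ∀ v v' : X, F v = t → F v' = t → v ≠ v' → 1 ≤ dist v v')
    (ξ : ℕ → X) (x : X)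
    (hξ : Tendsto (fun i => dist (f (ξ i)) (ξ (i + 1))) atTop (𝓝 0))
    (hshad : Tendsto (fun i => dist (f^[i] x) (ξ i)) atTop (𝓝 0))
    (ζ : ℕ → X)
    (hζ : Tendsto (fun i => dist (f (ζ i)) (ζ (i + 1))) atTop (𝓝 0))
    (hlift : ∀ i, F (ζ i) = ξ i) :
    ∃ z : X, F z = x ∧ Tendsto (fun i => dist (f^[i] z) (ζ i)) atTop (𝓝 0) := by
  have hcomm : Function.Commute F f := fun y => congrFun hFf y
  obtain ⟨w, hw, hwζ⟩ := hFopen.exists_asymptotic_lift hFc hFs ζ (fun i => f^[i] x)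
    (by simpa only [hlift] using hshad)
  have hfw : Tendsto (fun i => dist (f (w i)) (f (ζ i))) atTop (𝓝 0) := by
    have huc := CompactSpace.uniformContinuous_of_continuous hf
    exact tendsto_uniformity_iff_dist_tendsto_zero.1
      (Tendsto.comp huc
        (tendsto_uniformity_iff_dist_tendsto_zero (f := fun i => (w i, ζ i)).2 hwζ))
  have hsum := (hfw.add hζ).add ((tendsto_add_atTop_iff_nat 1).2 hwζ)
  simp only [add_zero] at hsum
  obtain ⟨N, hN⟩ := eventually_atTop.1 (hsum.eventually_lt_const one_pos)
  have hstep : ∀ i ≥ N, f (w i) = w (i + 1) := by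
    intro i hi
    by_contra hne
    have h1 := hfib (f^[i + 1] x) (f (w i)) (w (i + 1))
      (by rw [hcomm (w i), hw, Function.iterate_succ_apply']) (hw (i + 1)) hne
    have h2 := hN i hi
    have h3 := dist_triangle4 (f (w i)) (f (ζ i)) (ζ (i + 1)) (w (i + 1))
    rw [dist_comm (ζ (i + 1))] at h3
    linarith
  obtain ⟨z, hz⟩ := (hfb.iterate N).2 (w N)
  have horbit : ∀ i ≥ N, f^[i] z = w i := by
    intro i hi
    induction i, hi using Nat.le_induction with
    | base => exact hz
    | succ i hi ih => rw [Function.iterate_succ_apply', ih, hstep i hi]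
  refine ⟨z, (hfb.iterate N).1 ?_, hwζ.congr' ?_⟩
  · rw [← (hcomm.iterate_right N) z, hz, hw]
  · filter_upwards [eventually_ge_atTop N] with i hi
    rw [horbit i hi]
end

section
/- Let (X,d) be a compact metric space, f : X → X a homeomorphism, and F : X → X a factor map from (X,f) to itself such that (a) F is an open map, and (b) d(v,v') ≥ 1 for every t ∈ X and all distinct v,v' ∈ F^{-1}(t). Let Y = {(x_n)_{n≥1} ∈ X^ℕ : F(x_{n+1}) = x_n for all n ≥ 1}, equipped with the metric D((x_n),(y_n)) = sup_{n≥1} 2^{-n} d(x_n,y_n), and let g : Y → Y be defined by g((x_n)_{n≥1}) = (f(x_n))_{n≥1}. If f has the s-limit shadowing property, then g has the s-limit shadowing property. -/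
open Filter Topology Set

/-- `f` has the s-limit shadowing property. -/
def SLimitShadowing {X : Type*} [MetricSpace X] (f : X → X) : Prop :=
  ∀ ε > 0, ∃ δ > 0, ∀ ξ : ℕ → X,
    (∀ i, dist (f (ξ i)) (ξ (i + 1)) ≤ δ) →
    Tendsto (fun i => dist (f (ξ i)) (ξ (i + 1))) atTop (𝓝 0) →
    ∃ y : X, (∀ i, dist (f^[i] y) (ξ i) ≤ ε) ∧
      Tendsto (fun i => dist (f^[i] y) (ξ i)) atTop (𝓝 0)

/-- An open continuous self-map of a compact metric space is uniformly open. -/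
theorem IsOpenMap.exists_uniform_lift {X : Type*} [MetricSpace X] [CompactSpace X] {F : X → X}
    (hF : IsOpenMap F) (hFc : Continuous F) {η : ℝ} (hη : 0 < η) :
    ∃ θ > 0, ∀ x t, dist (F x) t < θ → ∃ x', F x' = t ∧ dist x' x < η := by
  have hopen : IsOpen (Prod.map id F '' {p : X × X | dist p.2 p.1 < η}) :=
    (IsOpenMap.id.prodMap hF) _ (isOpen_lt (by fun_prop) (by fun_prop))
  have hcpt : IsCompact (range fun x => (x, F x)) :=
    isCompact_range (by fun_prop)
  obtain ⟨θ, hθ, hsub⟩ := hcpt.exists_thickening_subset_open hopen (by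
    rintro _ ⟨x, rfl⟩
    exact ⟨(x, x), by simpa using hη, rfl⟩)
  refine ⟨θ, hθ, fun x t ht => ?_⟩
  obtain ⟨⟨a, b⟩, hab, hp⟩ := hsub (Metric.mem_thickening_iff.2
    ⟨(x, F x), ⟨x, rfl⟩, show dist (x, t) (x, F x) < θ by simpa [Prod.dist_eq, dist_comm t, hθ]⟩)
  obtain ⟨rfl, rfl⟩ := Prod.mk.inj hp
  exact ⟨b, rfl, hab⟩

/-- If the orbit of `y` is asymptotic to `F ∘ ζ` for an asymptotic pseudo orbit `ζ`, then `y` has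
a preimage under `F` whose orbit is asymptotic to `ζ`. -/
theorem exists_lift_asymptotic {X : Type*} [MetricSpace X] [CompactSpace X] {f F : X → X}
    (hf : Continuous f) (hfb : Function.Bijective f) (hFc : Continuous F)
    (hFf : Function.Commute F f) (hFopen : IsOpenMap F)
    (hfib : ∀ v v', F v = F v' → v ≠ v' → 1 ≤ dist v v')
    {ζ : ℕ → X} (hζ : Tendsto (fun i => dist (f (ζ i)) (ζ (i + 1))) atTop (𝓝 0))
    {y : X} (hy : Tendsto (fun i => dist (f^[i] y) (F (ζ i))) atTop (𝓝 0)) :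
    ∃ y', F y' = y ∧ Tendsto (fun i => dist (f^[i] y') (ζ i)) atTop (𝓝 0) := by
  have hlift : ∀ η > 0, ∀ᶠ i in atTop, ∃ w, F w = f^[i] y ∧ dist w (ζ i) < η := by
    intro η hη
    obtain ⟨θ, hθ, h⟩ := hFopen.exists_uniform_lift hFc hη
    filter_upwards [hy.eventually (gt_mem_nhds hθ)] with i hi
    exact h _ _ (by rwa [dist_comm])
  obtain ⟨α₀, hα₀, hα₀f⟩ := Metric.uniformContinuous_iff.1
    (CompactSpace.uniformContinuous_of_continuous hf) (1 / 3) (by norm_num)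
  have hα : 0 < min α₀ (1 / 3) := by positivity
  obtain ⟨T, hT⟩ := eventually_atTop.1
    ((hlift _ hα).and (hζ.eventually (gt_mem_nhds (show (0 : ℝ) < 1 / 3 by norm_num))))
  obtain ⟨z, hz, hzd⟩ := (hT T le_rfl).1
  obtain ⟨y', rfl⟩ := (hfb.iterate T).2 z
  have hFy : F y' = y := (hfb.iterate T).1 (by rw [← hz, (hFf.iterate_right T).eq])
  have hFi : ∀ i, F (f^[i] y') = f^[i] y := fun i => by rw [(hFf.iterate_right i).eq, hFy]
  have heq : ∀ i w, F w = f^[i] y → dist w (ζ i) < 1 / 3 → dist (f^[i] y') (ζ i) < 2 / 3 →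
      f^[i] y' = w := by
    intro i w hw hwd hd
    by_contra hne
    have := hfib _ _ ((hFi i).trans hw.symm) hne
    linarith [dist_triangle_right (f^[i] y') w (ζ i)]
  have hclose : ∀ i ≥ T, dist (f^[i] y') (ζ i) < min α₀ (1 / 3) := by
    intro i hi
    induction i, hi using Nat.le_induction with
    | base => exact hzd
    | succ i hi ih =>
      obtain ⟨w, hw, hwd⟩ := (hT (i + 1) (by omega)).1
      have h₁ := hα₀f (ih.trans_le (min_le_left _ _))
      rw [← Function.iterate_succ_apply' f] at h₁
      rwa [heq _ w hw (hwd.trans_le (min_le_right _ _))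
        (by linarith [dist_triangle (f^[i + 1] y') (f (ζ i)) (ζ (i + 1)), (hT i hi).2])]
  refine ⟨y', hFy, Metric.tendsto_nhds.2 fun η hη => ?_⟩
  filter_upwards [hlift (min η (1 / 3)) (by positivity), eventually_ge_atTop T]
    with i ⟨w, hw, hwd⟩ hi
  rw [heq i w hw (hwd.trans_le (min_le_right _ _))
    (by linarith [(hclose i hi).trans_le (min_le_right _ _)])]
  simpa using hwd.trans_le (min_le_left _ _)

/-- A continuous self-map of a compact metric space preserves asymptotic pairs of sequences. -/
theorem Continuous.tendsto_dist_comp_zero {X : Type*} [MetricSpace X] [CompactSpace X] {F : X → X}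
    (hF : Continuous F) {u v : ℕ → X} (h : Tendsto (fun i => dist (u i) (v i)) atTop (𝓝 0)) :
    Tendsto (fun i => dist (F (u i)) (F (v i))) atTop (𝓝 0) :=
  tendsto_uniformity_iff_dist_tendsto_zero (f := fun i => (F (u i), F (v i))).1
    (Tendsto.comp (CompactSpace.uniformContinuous_of_continuous hF)
      (tendsto_uniformity_iff_dist_tendsto_zero (f := fun i => (u i, v i)).2 h))

/-- Finitely many iterates of a continuous self-map of a compact metric space have a common
modulus of continuity. -/
theorem exists_iterate_modulus {X : Type*} [MetricSpace X] [CompactSpace X] {F : X → X}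
    (hF : Continuous F) (N : ℕ) {ε : ℝ} (hε : 0 < ε) :
    ∃ ε' > 0, ∀ k ≤ N, ∀ a b, dist a b ≤ ε' → dist (F^[k] a) (F^[k] b) ≤ ε := by
  have h : ∀ᶠ r in 𝓝[>] (0 : ℝ), ∀ k ∈ Iic N, ∀ a b, dist a b ≤ r →
      dist (F^[k] a) (F^[k] b) ≤ ε := by
    refine (eventually_all_finite (finite_Iic N)).2 fun k _ => ?_
    obtain ⟨r₀, hr₀, h⟩ := Metric.uniformContinuous_iff.1
      (CompactSpace.uniformContinuous_of_continuous (hF.iterate k)) ε hε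
    filter_upwards [Ioo_mem_nhdsGT hr₀] with r hr a b hab
    exact (h (hab.trans_lt hr.2)).le
  obtain ⟨r, hr, hr0⟩ := (h.and self_mem_nhdsWithin).exists
  exact ⟨r, hr0, hr⟩

section WeightedSup

variable {X : Type*} [MetricSpace X] [CompactSpace X]

theorem weighted_dist_le_diam (u v : ℕ → X) (n : ℕ) :
    (2 : ℝ)⁻¹ ^ (n + 1) * dist (u n) (v n) ≤ (2 : ℝ)⁻¹ ^ (n + 1) * Metric.diam (univ : Set X) :=
  mul_le_mul_of_nonneg_left
    (Metric.dist_le_diam_of_mem isCompact_univ.isBounded (mem_univ _) (mem_univ _)) (by positivity)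

theorem dist_le_mul_weighted_iSup (u v : ℕ → X) (n : ℕ) :
    dist (u n) (v n) ≤ 2 ^ (n + 1) * ⨆ n : ℕ, (2 : ℝ)⁻¹ ^ (n + 1) * dist (u n) (v n) := by
  have hb : BddAbove (range fun n : ℕ => (2 : ℝ)⁻¹ ^ (n + 1) * dist (u n) (v n)) := by
    refine ⟨Metric.diam (univ : Set X), ?_⟩
    rintro _ ⟨n, rfl⟩
    exact (weighted_dist_le_diam u v n).trans (mul_le_of_le_one_left Metric.diam_nonneg
      (pow_le_one₀ (by norm_num) (by norm_num)))
  have h := le_ciSup hb n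
  rw [inv_pow] at h
  rwa [inv_mul_le_iff₀ (by positivity)] at h

theorem exists_weighted_iSup_le (X : Type*) [MetricSpace X] [CompactSpace X]
    {ε : ℝ} (hε : 0 < ε) :
    ∃ N : ℕ, ∀ u v : ℕ → X, (∀ n ≤ N, dist (u n) (v n) ≤ ε) →
      ⨆ n : ℕ, (2 : ℝ)⁻¹ ^ (n + 1) * dist (u n) (v n) ≤ ε := by
  have ht : Tendsto (fun n : ℕ => (2 : ℝ)⁻¹ ^ (n + 1) * Metric.diam (univ : Set X))
      atTop (𝓝 0) := by
    simpa using ((tendsto_pow_atTop_nhds_zero_of_lt_one (r := (2 : ℝ)⁻¹) (by norm_num)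
      (by norm_num)).comp (tendsto_add_atTop_nat 1)).mul_const (Metric.diam (univ : Set X))
  obtain ⟨N, hN⟩ := eventually_atTop.1 (ht.eventually (gt_mem_nhds hε))
  refine ⟨N, fun u v h => ciSup_le fun n => ?_⟩
  rcases le_total n N with hn | hn
  · exact (mul_le_of_le_one_left dist_nonneg
      (pow_le_one₀ (by norm_num) (by norm_num))).trans (h n hn)
  · exact (weighted_dist_le_diam u v n).trans (hN n hn).le

theorem tendsto_weighted_iSup_zero {u v : ℕ → ℕ → X}
    (h : ∀ n, Tendsto (fun i => dist (u i n) (v i n)) atTop (𝓝 0)) :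
    Tendsto (fun i => ⨆ n : ℕ, (2 : ℝ)⁻¹ ^ (n + 1) * dist (u i n) (v i n)) atTop (𝓝 0) := by
  refine Metric.tendsto_nhds.2 fun ε hε => ?_
  obtain ⟨N, hN⟩ := exists_weighted_iSup_le X (half_pos hε)
  filter_upwards [(eventually_all_finite (finite_Iic N)).2 fun n _ =>
    (h n).eventually (gt_mem_nhds (half_pos hε))] with i hi
  rw [Real.dist_0_eq_abs, abs_of_nonneg (Real.iSup_nonneg fun n => by positivity)]
  linarith [hN (u i) (v i) fun n hn => (hi n hn).le]

end WeightedSup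

/-- Lemma 4.3: the inverse limit of `(X,f)` along an open factor map `F` with
`1`-separated fibers inherits the s-limit shadowing property. -/
theorem stmt_16 {X : Type*} [MetricSpace X] [CompactSpace X] (f : X → X)
    (hf : Continuous f) (hfb : Function.Bijective f)
    (F : X → X) (hFc : Continuous F) (hFs : Function.Surjective F)
    (hFf : F ∘ f = f ∘ F) (hFopen : IsOpenMap F)
    (hfib : ∀ t : X, ∀ v v' : X, F v = t → F v' = t → v ≠ v' → 1 ≤ dist v v')
    (Y : Set (ℕ → X)) (hY : Y = {u | ∀ n, F (u (n + 1)) = u n})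
    (g : (ℕ → X) → (ℕ → X)) (hg : ∀ u n, g u n = f (u n))
    (D : (ℕ → X) → (ℕ → X) → ℝ)
    (hD : ∀ u v, D u v = ⨆ n : ℕ, (2 : ℝ)⁻¹ ^ (n + 1) * dist (u n) (v n))
    (hslf : SLimitShadowing f) :
    ∀ ε > 0, ∃ δ > 0, ∀ ξ : ℕ → (ℕ → X), (∀ i, ξ i ∈ Y) →
      (∀ i, D (g (ξ i)) (ξ (i + 1)) ≤ δ) →
      Tendsto (fun i => D (g (ξ i)) (ξ (i + 1))) atTop (𝓝 0) →
      ∃ y ∈ Y, (∀ i, D (g^[i] y) (ξ i) ≤ ε) ∧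
        Tendsto (fun i => D (g^[i] y) (ξ i)) atTop (𝓝 0) := by
  intro ε hε
  subst hY
  have hcomm : Function.Commute F f := congrFun hFf
  obtain ⟨N, hN⟩ := exists_weighted_iSup_le X hε
  obtain ⟨ε', hε', hmod⟩ := exists_iterate_modulus hFc N hε
  obtain ⟨δ, hδ, hsh⟩ := hslf ε' hε'
  refine ⟨δ / 2 ^ (N + 1), by positivity, fun ξ hξ hξδ hξ0 => ?_⟩
  have hcoord : ∀ n i, dist (f (ξ i n)) (ξ (i + 1) n) ≤ 2 ^ (n + 1) * D (g (ξ i)) (ξ (i + 1)) :=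
    fun n i => by simpa only [hD, hg] using dist_le_mul_weighted_iSup (g (ξ i)) (ξ (i + 1)) n
  have hasymp : ∀ n, Tendsto (fun i => dist (f (ξ i n)) (ξ (i + 1) n)) atTop (𝓝 0) := fun n =>
    squeeze_zero (fun _ => dist_nonneg) (hcoord n) (by simpa using hξ0.const_mul (2 ^ (n + 1)))
  obtain ⟨x, hxε, hx0⟩ := hsh (fun i => ξ i N) (fun i => (hcoord N i).trans (by
    rw [← le_div_iff₀' (by positivity)]; exact hξδ i)) (hasymp N)
  have hup : ∀ n y, Tendsto (fun i => dist (f^[i] y) (ξ i n)) atTop (𝓝 0) →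
      ∃ y', F y' = y ∧ Tendsto (fun i => dist (f^[i] y') (ξ i (n + 1))) atTop (𝓝 0) :=
    fun n y hy => exists_lift_asymptotic hf hfb hFc hcomm hFopen
      (fun v v' h => hfib _ v v' h rfl) (hasymp (n + 1)) (by simpa only [hξ _ n] using hy)
  choose! lift hliftF hlift0 using hup
  let a : ℕ → X := fun k => Nat.rec x (fun k y => lift (N + k) y) k
  have ha0 : ∀ k, Tendsto (fun i => dist (f^[i] (a k)) (ξ i (N + k))) atTop (𝓝 0) := by
    intro k
    induction k with
    | zero => exact hx0
    | succ k ih => exact hlift0 _ _ ih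
  have haF : ∀ k, F (a (k + 1)) = a k := fun k => hliftF _ _ (ha0 k)
  have haFk : ∀ k m, F^[k] (a (m + k)) = a m := by
    intro k m
    induction k with
    | zero => rfl
    | succ k ih => rw [Function.iterate_succ_apply, ← add_assoc, haF, ih]
  have hξF : ∀ k m i, F^[k] (ξ i (m + k)) = ξ i m := by
    intro k m i
    induction k with
    | zero => rfl
    | succ k ih => rw [Function.iterate_succ_apply, ← add_assoc, hξ i, ih]
  have hgi : ∀ i (u : ℕ → X) n, g^[i] u n = f^[i] (u n) := by
    intro i u n
    induction i with
    | zero => rfl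
    | succ i ih => rw [Function.iterate_succ_apply', Function.iterate_succ_apply', hg, ih]
  refine ⟨fun n => F^[N] (a n), fun n => ?_, fun i => ?_, ?_⟩
  · rw [← Function.iterate_succ_apply' F, Function.iterate_succ_apply, haF]
  · rw [hD]
    refine hN _ _ fun n hn => ?_
    obtain ⟨k, rfl⟩ := Nat.exists_eq_add_of_le hn
    have h₁ : F^[n + k] (a n) = F^[k] x := by
      have h₀ : F^[n] (a n) = x := by
        have h := haFk n 0
        rw [zero_add] at h
        exact h
      rw [add_comm, Function.iterate_add_apply, h₀]
    rw [hgi, h₁, ← ((hcomm.iterate_iterate k i).eq x), ← hξF k n i]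
    exact hmod k (by omega) _ _ (hxε i)
  · simp only [hD]
    refine tendsto_weighted_iSup_zero fun n => ?_
    have h₁ := (hFc.iterate N).tendsto_dist_comp_zero (ha0 n)
    simpa only [hgi, ← (hcomm.iterate_iterate N _).eq (a n), add_comm N n, hξF] using h₁
end

section
/- Let σ be the shift homeomorphism on {0,1}^ℤ with the metric d(x,y) = sup_{n∈ℤ} 2^{-|n|}|x_n − y_n|, and let F : {0,1}^ℤ → {0,1}^ℤ be defined by F(x)_n = x_n + x_{n+1} (mod 2) for all n ∈ ℤ. If (x,y) is an asymptotic pair for σ and z,w ∈ {0,1}^ℤ satisfy F(z) = x and F(w) = y, then (z,w) is not a scrambled pair for σ: either (z,w) is an asymptotic pair for σ, or liminf_{i→∞} d(σ^i(z),σ^i(w)) = 1 (so (z,w) is a distal pair for σ). -/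
open Filter Topology Set

/-- The metric `d(x,y) = sup_{n ∈ ℤ} 2^{-|n|} |x_n - y_n|` on `{0,1}^ℤ`. -/
noncomputable def Dz (x y : ℤ → Bool) : ℝ :=
  ⨆ n : ℤ, (2 : ℝ) ^ (-|n|) * (if x n = y n then 0 else 1)

/-- The shift map `σ` on `{0,1}^ℤ`. -/
def shiftZ (x : ℤ → Bool) : ℤ → Bool := fun n => x (n + 1)

/-- The factor map `F(x)_n = x_n + x_{n+1} (mod 2)`. -/
def Fmap (x : ℤ → Bool) : ℤ → Bool := fun n => xor (x n) (x (n + 1))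

/-- `(x,y)` is an asymptotic pair for `σ`. -/
def AsymptoticZ (x y : ℤ → Bool) : Prop :=
  Filter.Tendsto (fun i : ℕ => Dz (shiftZ^[i] x) (shiftZ^[i] y))
    Filter.atTop (nhds 0)

/-- `(x,y)` is a scrambled pair for `σ`. -/
def ScrambledZ (x y : ℤ → Bool) : Prop :=
  0 < Filter.limsup (fun i : ℕ => Dz (shiftZ^[i] x) (shiftZ^[i] y)) Filter.atTop ∧
    Filter.liminf (fun i : ℕ => Dz (shiftZ^[i] x) (shiftZ^[i] y)) Filter.atTop = 0

theorem Dz_term_nonneg (x y : ℤ → Bool) (n : ℤ) :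
    0 ≤ (2 : ℝ) ^ (-|n|) * (if x n = y n then 0 else 1) := by
  split_ifs <;> positivity

theorem Dz_term_le_one (x y : ℤ → Bool) (n : ℤ) :
    (2 : ℝ) ^ (-|n|) * (if x n = y n then 0 else 1) ≤ 1 := by
  split_ifs
  · simp
  · rw [mul_one]
    exact zpow_le_one_of_nonpos₀ one_le_two (by simp)

theorem Dz_le_one (x y : ℤ → Bool) : Dz x y ≤ 1 :=
  ciSup_le (Dz_term_le_one x y)

theorem Dz_nonneg (x y : ℤ → Bool) : 0 ≤ Dz x y :=
  Real.iSup_nonneg (Dz_term_nonneg x y)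

theorem Dz_eq_one_of_ne {x y : ℤ → Bool} (h : x 0 ≠ y 0) : Dz x y = 1 := by
  refine le_antisymm (Dz_le_one x y) ?_
  have hb : BddAbove (range fun n : ℤ => (2 : ℝ) ^ (-|n|) * (if x n = y n then 0 else 1)) :=
    ⟨1, by rintro _ ⟨n, rfl⟩; exact Dz_term_le_one x y n⟩
  calc (1 : ℝ) = 2 ^ (-|(0 : ℤ)|) * (if x 0 = y 0 then 0 else 1) := by simp [h]
    _ ≤ Dz x y := le_ciSup hb 0

theorem shiftZ_iterate_apply (x : ℤ → Bool) (i : ℕ) (n : ℤ) :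
    shiftZ^[i] x n = x (n + i) := by
  induction i generalizing n with
  | zero => simp
  | succ i ih =>
    rw [Function.iterate_succ_apply', shiftZ, ih]
    push_cast
    ring_nf

theorem Dz_shiftZ_iterate_eq_one {x y : ℤ → Bool} {i : ℕ} (h : x i ≠ y i) :
    Dz (shiftZ^[i] x) (shiftZ^[i] y) = 1 :=
  Dz_eq_one_of_ne (by simpa [shiftZ_iterate_apply] using h)

theorem AsymptoticZ.exists_forall_ge_eq {x y : ℤ → Bool} (h : AsymptoticZ x y) :
    ∃ N : ℕ, ∀ i : ℕ, N ≤ i → x i = y i := by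
  obtain ⟨N, hN⟩ := eventually_atTop.1 (h.eventually_lt_const one_pos)
  refine ⟨N, fun i hi => ?_⟩
  by_contra hne
  exact (hN i hi).ne (Dz_shiftZ_iterate_eq_one hne)

theorem asymptoticZ_of_forall_ge_eq {x y : ℤ → Bool} {N : ℕ}
    (h : ∀ i : ℕ, N ≤ i → x i = y i) : AsymptoticZ x y := by
  have hlim : Tendsto (fun i : ℕ => (2 : ℝ) ^ N * (1 / 2) ^ i) atTop (𝓝 0) := by
    simpa using (tendsto_pow_atTop_nhds_zero_of_lt_one (r := (1 / 2 : ℝ))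
      (by norm_num) (by norm_num)).const_mul ((2 : ℝ) ^ N)
  refine squeeze_zero (fun i => Dz_nonneg _ _) (fun i => ciSup_le fun n => ?_) hlim
  simp only [shiftZ_iterate_apply]
  split_ifs with hn
  · simp only [mul_zero]
    positivity
  · have hlt : n + i < N := by
      by_contra! hge
      obtain ⟨k, hk⟩ := Int.eq_ofNat_of_zero_le (show 0 ≤ n + i by lia)
      rw [hk] at hn hge
      exact hn (h k (by exact_mod_cast hge))
    have hexp : -|n| ≤ (N : ℤ) - i := by linarith [neg_abs_le n]
    calc (2 : ℝ) ^ (-|n|) * 1 ≤ 2 ^ ((N : ℤ) - i) := by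
          rw [mul_one]
          exact zpow_le_zpow_right₀ one_le_two hexp
      _ = 2 ^ N * (1 / 2) ^ i := by
          rw [zpow_sub₀ two_ne_zero, zpow_natCast, zpow_natCast, one_div, inv_pow, div_eq_mul_inv]

theorem xor_eq_of_Fmap_eq {z w : ℤ → Bool} {N : ℕ}
    (h : ∀ i : ℕ, N ≤ i → Fmap z i = Fmap w i) {i : ℕ} (hi : N ≤ i) :
    xor (z i) (w i) = xor (z N) (w N) := by
  induction i, hi using Nat.le_induction with
  | base => rfl
  | succ i hi ih =>
    have hF := h i hi
    simp only [Fmap] at hF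
    rw [← ih]
    push_cast
    revert hF
    cases z i <;> cases w i <;> cases z (i + 1) <;> cases w (i + 1) <;> simp

/-- If `(x,y)` is an asymptotic pair for the shift `σ` on `{0,1}^ℤ` and
`F(z) = x`, `F(w) = y`, then `(z,w)` is not a scrambled pair for `σ`: either
`(z,w)` is an asymptotic pair, or `liminf_i d(σ^i z, σ^i w) = 1` (a distal pair). -/
theorem stmt_18 (x y z w : ℤ → Bool) (hxy : AsymptoticZ x y)
    (hz : Fmap z = x) (hw : Fmap w = y) :
    ¬ ScrambledZ z w ∧
      (AsymptoticZ z w ∨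
        Filter.liminf (fun i : ℕ => Dz (shiftZ^[i] z) (shiftZ^[i] w))
          Filter.atTop = 1) := by
  have key : AsymptoticZ z w ∨
      Tendsto (fun i : ℕ => Dz (shiftZ^[i] z) (shiftZ^[i] w)) atTop (𝓝 1) := by
    subst hz hw
    obtain ⟨N, hN⟩ := hxy.exists_forall_ge_eq
    by_cases hNN : z N = w N
    · refine .inl (asymptoticZ_of_forall_ge_eq (N := N) fun i hi => ?_)
      simpa [hNN] using xor_eq_of_Fmap_eq hN hi
    · refine .inr (tendsto_const_nhds.congr' ?_)
      filter_upwards [eventually_ge_atTop N] with i hi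
      refine (Dz_shiftZ_iterate_eq_one fun hne => hNN ?_).symm
      simpa [hne] using xor_eq_of_Fmap_eq hN hi
  refine ⟨?_, key.imp_right fun h => h.liminf_eq⟩
  rintro ⟨hsup, hinf⟩
  rcases key with h | h
  · exact hsup.ne' h.limsup_eq
  · exact one_ne_zero (h.liminf_eq.symm.trans hinf)
end
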